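/- arXiv:1109.1078 — 2 statements merged into one kernel-verified Lean document; each statement's English description precedes it below -/
import Mathlib

section
/- Let d ≥ 1 and 0 ≤ m < d be integers. There exists a constant f(d,m) > 0 depending only on d and m with the following property: for every positive integer n and every coloring of the n^d small cubes of the standard partition of the unit cube in m+1 colors, there exists a monochromatic connected component containing at least f(d,m)·n^{d−m} small cubes. -/
/-- Two small cubes of the standard partition of `[0,1]^d` into `n^d` cubes,
indexed by `a, b : Fin d → Fin n`, are adjacent iff their closed cubes intersect,
i.e. iff `|a i - b i| ≤ 1` for every coordinate `i`. -/
def cubeAdj {d n : ℕ} (a b : Fin d → Fin n) : Prop :=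
  ∀ i : Fin d, (a i : ℤ) ≤ (b i : ℤ) + 1 ∧ (b i : ℤ) ≤ (a i : ℤ) + 1

/-- The monochromatic connected component (for the coloring `χ`) containing the
small cube indexed by `a`: all cubes reachable from `a` by a chain of adjacent
cubes in which consecutive cubes have the same color (hence the whole chain is
monochromatic of the color of `a`). -/
def monoComponent {d n : ℕ} {α : Type*} (χ : (Fin d → Fin n) → α) (a : Fin d → Fin n) :
    Set (Fin d → Fin n) :=
  {b | Relation.ReflTransGen (fun x y => cubeAdj x y ∧ χ x = χ y) a b}

/-- The coboundary of a cochain with `ZMod 2` coefficients, a cochain being a function on lists of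
vertices: the sum of the values of `f` at the lists obtained by deleting one entry. -/
def coboundary {V : Type*} : (List V → ZMod 2) → List V → ZMod 2
  | _, [] => 0
  | f, x :: l => f l + coboundary (fun l' => f (x :: l')) l

/-- The prism operator of two vertex maps `φ` and `ψ`: the sum of the values of `f` at the lists
`φ x₀, …, φ xᵢ, ψ xᵢ, …, ψ xₖ`. -/
def prism {V : Type*} (φ ψ : V → V) : (List V → ZMod 2) → List V → ZMod 2
  | _, [] => 0
  | f, x :: l => f (φ x :: ψ x :: l.map ψ) + prism φ ψ (fun l' => f (φ x :: l')) l

section Cochains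

variable {V W : Type*}

lemma coboundary_add (f g : List V → ZMod 2) (l : List V) :
    coboundary (fun l => f l + g l) l = coboundary f l + coboundary g l := by
  induction l generalizing f g with
  | nil => simp [coboundary]
  | cons x l ih => simp only [coboundary, ih]; ring

lemma coboundary_sum {ι : Type*} (s : Finset ι) (f : ι → List V → ZMod 2) (l : List V) :
    coboundary (fun l => ∑ i ∈ s, f i l) l = ∑ i ∈ s, coboundary (f i) l := by
  induction l generalizing f with
  | nil => simp [coboundary]
  | cons x l ih => simp only [coboundary, ih, Finset.sum_add_distrib]

lemma coboundary_comp_map (φ : V → W) (f : List W → ZMod 2) (l : List V) :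
    coboundary (fun l => f (l.map φ)) l = coboundary f (l.map φ) := by
  induction l generalizing f with
  | nil => simp [coboundary]
  | cons x l ih => simp only [coboundary, List.map_cons, ih (fun l' => f (φ x :: l'))]

lemma prism_add (φ ψ : V → V) (f g : List V → ZMod 2) (l : List V) :
    prism φ ψ (fun l => f l + g l) l = prism φ ψ f l + prism φ ψ g l := by
  induction l generalizing f g with
  | nil => simp [prism]
  | cons x l ih => simp only [prism, ih]; ring

lemma coboundary_prism (φ ψ : V → V) (f : List V → ZMod 2) (l : List V) :
    coboundary (prism φ ψ f) l + prism φ ψ (coboundary f) l = f (l.map φ) + f (l.map ψ) := by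
  induction l generalizing f with
  | nil => simp [coboundary, prism, CharTwo.add_self_eq_zero]
  | cons x l ih =>
    have h := ih (fun l' => f (φ x :: l'))
    simp only [coboundary, prism, List.map_cons, coboundary_add, prism_add,
      coboundary_comp_map ψ (fun l' => f (φ x :: ψ x :: l'))] at h ⊢
    have h2 : (2 : ZMod 2) = 0 := rfl
    linear_combination h + (prism φ ψ f l +
      coboundary (fun l' => f (φ x :: ψ x :: l')) (l.map ψ) + f (φ x :: l.map ψ)) * h2

lemma exists_of_prism_ne_zero {φ ψ : V → V} {f : List V → ZMod 2} {l : List V}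
    (h : prism φ ψ f l ≠ 0) :
    ∃ l₁ x l₂, l = l₁ ++ x :: l₂ ∧ f (l₁.map φ ++ φ x :: ψ x :: l₂.map ψ) ≠ 0 := by
  induction l generalizing f with
  | nil => simp [prism] at h
  | cons x l ih =>
    by_cases h0 : f (φ x :: ψ x :: l.map ψ) = 0
    · simp only [prism, h0, zero_add] at h
      obtain ⟨l₁, y, l₂, rfl, hy⟩ := ih h
      exact ⟨x :: l₁, y, l₂, rfl, hy⟩
    · exact ⟨[], x, l, rfl, h0⟩

lemma coboundary_sum_prism (φ : ℕ → V → V) (N : ℕ) (f : List V → ZMod 2) (l : List V) :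
    coboundary (fun l => ∑ s ∈ Finset.range N, prism (φ s) (φ (s + 1)) f l) l +
      ∑ s ∈ Finset.range N, prism (φ s) (φ (s + 1)) (coboundary f) l =
    f (l.map (φ 0)) + f (l.map (φ N)) := by
  rw [coboundary_sum, ← Finset.sum_add_distrib]
  simp only [coboundary_prism]
  induction N with
  | zero => simp [CharTwo.add_self_eq_zero]
  | succ N ih =>
    rw [Finset.sum_range_succ, ih]
    linear_combination CharTwo.add_self_eq_zero (f (l.map (φ N)))

/-- The cochain that takes the value `1` at the enumerations of the multiset `S`. -/
def indicatorCochain {ι : Type*} [DecidableEq ι] (S : Multiset ι) (l : List ι) : ZMod 2 :=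
  if (l : Multiset ι) = S then 1 else 0

lemma coboundary_zero (l : List V) : coboundary (fun _ => (0 : ZMod 2)) l = 0 := by
  induction l with
  | nil => rfl
  | cons x l ih => simp [coboundary, ih]

lemma coboundary_indicatorCochain {ι : Type*} [DecidableEq ι] [Fintype ι] (S : Multiset ι)
    (l : List ι) :
    coboundary (indicatorCochain S) l =
      ∑ j, (S.count j + 1 : ZMod 2) * indicatorCochain (j ::ₘ S) l := by
  induction l generalizing S with
  | nil => simp [coboundary, indicatorCochain, Multiset.zero_ne_cons]
  | cons x l ih =>
    have key : ∀ T : Multiset ι, indicatorCochain T (x :: l) =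
        if x ∈ T then indicatorCochain (T.erase x) l else 0 := by
      intro T
      unfold indicatorCochain
      by_cases hx : x ∈ T
      · obtain ⟨U, rfl⟩ := Multiset.exists_cons_of_mem hx
        simp [← Multiset.cons_coe]
      · have : ((x :: l : List ι) : Multiset ι) ≠ T := by
          rintro rfl; simp at hx
        simp [hx, this]
    by_cases hx : x ∈ S
    · obtain ⟨U, rfl⟩ := Multiset.exists_cons_of_mem hx
      have h1 : (fun l' => indicatorCochain (x ::ₘ U) (x :: l')) = indicatorCochain U := by
        funext l'
        simp [indicatorCochain, ← Multiset.cons_coe]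
      simp only [coboundary, h1, ih]
      have h2 : ∀ j, indicatorCochain (j ::ₘ x ::ₘ U) (x :: l) =
          indicatorCochain (j ::ₘ U) l := by
        intro j
        simp [indicatorCochain, ← Multiset.cons_coe, Multiset.cons_swap j x]
      simp only [h2, Multiset.count_cons, Nat.cast_add, Nat.cast_ite, add_mul,
        Finset.sum_add_distrib]
      simp
      ring
    · have h1 : (fun l' => indicatorCochain S (x :: l')) = fun _ => 0 := by
        funext l'
        have : ((x :: l' : List ι) : Multiset ι) ≠ S := by
          rintro rfl; simp at hx
        simp [indicatorCochain, this]
      simp only [coboundary, h1, coboundary_zero]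
      rw [Finset.sum_eq_single x]
      · simp [key, Multiset.count_eq_zero_of_notMem hx]
      · intro j _ hj
        simp [key, hx, hj.symm]
      · simp

lemma coboundary_indicatorCochain_finset {ι : Type*} [DecidableEq ι] [Fintype ι] (s : Finset ι)
    (l : List ι) :
    coboundary (indicatorCochain s.val) l =
      ∑ j ∈ sᶜ, indicatorCochain (insert j s).val l := by
  rw [coboundary_indicatorCochain, ← Finset.sum_compl_add_sum s]
  have h1 : ∑ j ∈ s, (s.val.count j + 1 : ZMod 2) * indicatorCochain (j ::ₘ s.val) l = 0 := by
    refine Finset.sum_eq_zero fun j hj => ?_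
    rw [Multiset.count_eq_one_of_mem s.nodup hj]
    simp [CharTwo.add_self_eq_zero]
  rw [h1, add_zero]
  refine Finset.sum_congr rfl fun j hj => ?_
  have hj' : j ∉ s := by simpa using hj
  rw [Multiset.count_eq_zero_of_notMem (by simpa using hj'), Finset.insert_val_of_notMem hj']
  simp

lemma sum_compl_sum_compl_insert {ι : Type*} [DecidableEq ι] [Fintype ι] (s : Finset ι)
    (F : Finset ι → ZMod 2) :
    ∑ j ∈ sᶜ, ∑ k ∈ (insert j s)ᶜ, F (insert k (insert j s)) = 0 := by
  rw [Finset.sum_sigma']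
  refine Finset.sum_involution (fun p _ => ⟨p.2, p.1⟩) ?_ ?_ ?_ ?_
  · rintro ⟨j, k⟩ _
    rw [Finset.insert_comm k j, CharTwo.add_self_eq_zero]
  · rintro ⟨j, k⟩ h _ he
    simp only [Finset.mem_sigma, Finset.mem_compl, Finset.mem_insert, not_or] at h
    simp only [Sigma.mk.injEq, heq_eq_eq] at he
    exact h.2.1 he.1
  · rintro ⟨j, k⟩ h
    simp only [Finset.mem_sigma, Finset.mem_compl, Finset.mem_insert, not_or] at h ⊢
    exact ⟨h.2.2, Ne.symm h.2.1, h.1⟩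
  · rintro ⟨j, k⟩ _
    rfl

end Cochains

section Grid

variable {d n : ℕ}

/-- The vertices of the list are pairwise adjacent. -/
def IsClique (l : List (Fin d → Fin n)) : Prop := ∀ x ∈ l, ∀ y ∈ l, cubeAdj x y

/-- The pairwise adjacent lists of length `k` at which the cochain `f` does not vanish. -/
def cochainSupport (k : ℕ) (f : List (Fin d → Fin n) → ZMod 2) : Set (List (Fin d → Fin n)) :=
  {l | l.length = k ∧ IsClique l ∧ f l ≠ 0}

lemma finite_cochainSupport (k : ℕ) (f : List (Fin d → Fin n) → ZMod 2) :
    (cochainSupport k f).Finite :=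
  (List.finite_length_eq _ k).subset fun _ hl => hl.1

lemma ncard_cochainSupport_add_le (k : ℕ) (f g : List (Fin d → Fin n) → ZMod 2) :
    (cochainSupport k fun l => f l + g l).ncard ≤
      (cochainSupport k f).ncard + (cochainSupport k g).ncard := by
  refine (Set.ncard_le_ncard ?_ ((finite_cochainSupport k f).union
    (finite_cochainSupport k g))).trans (Set.ncard_union_le _ _)
  rintro l ⟨h1, h2, h3⟩
  by_cases hf : f l = 0
  · exact Or.inr ⟨h1, h2, by simpa [hf] using h3⟩
  · exact Or.inl ⟨h1, h2, hf⟩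

lemma ncard_cochainSupport_sum_le {ι : Type*} (k : ℕ) (s : Finset ι)
    (f : ι → List (Fin d → Fin n) → ZMod 2) :
    (cochainSupport k fun l => ∑ i ∈ s, f i l).ncard ≤
      ∑ i ∈ s, (cochainSupport k (f i)).ncard := by
  classical
  induction s using Finset.induction_on with
  | empty => simp [cochainSupport]
  | insert i s hi ih =>
    simp only [Finset.sum_insert hi]
    exact (ncard_cochainSupport_add_le k _ _).trans (Nat.add_le_add_left ih _)

lemma IsClique.map {l : List (Fin d → Fin n)} (hl : IsClique l)
    {φ : (Fin d → Fin n) → Fin d → Fin n} (hφ : ∀ x y, cubeAdj x y → cubeAdj (φ x) (φ y)) :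
    IsClique (l.map φ) := by
  simp only [IsClique, List.mem_map]
  rintro _ ⟨x, hx, rfl⟩ _ ⟨y, hy, rfl⟩
  exact hφ _ _ (hl x hx y hy)

lemma cubeAdj_refl (x : Fin d → Fin n) : cubeAdj x x := fun _ => by omega

lemma cubeAdj.symm {x y : Fin d → Fin n} (h : cubeAdj x y) : cubeAdj y x := fun i => (h i).symm

/-- Adjacent cubes remain adjacent after being projected to a slice. -/
lemma cubeAdj.update {x y : Fin d → Fin n} (h : cubeAdj x y) (j : Fin d) (t : Fin n) :
    cubeAdj (Function.update x j t) (Function.update y j t) := by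
  intro i
  by_cases hi : i = j
  · subst hi; simp
  · simpa [hi] using h i

/-- There are at most `n * 3 ^ k` pairwise adjacent lists of length `k` with a given projection to
a coordinate slice. -/
lemma ncard_le_of_projection (j : Fin d) (t : Fin n) (k : ℕ)
    (S U : Set (List (Fin d → Fin n))) (hU : U.Finite) (hk : ∀ l ∈ S, l.length = k)
    (hS : ∀ l ∈ S, IsClique l)
    (hSU : ∀ l ∈ S, ∃ w ∈ U,
      l.map (fun x => Function.update x j t) = w.map (fun x => Function.update x j t)) :
    S.ncard ≤ U.ncard * (n * 3 ^ k) := by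
  classical
  have hn : 0 < n := t.pos
  let dec : Fin n → Fin 3 → Fin n := fun c e => ⟨min (c + e - 1) (n - 1), by omega⟩
  let p : (Fin d → Fin n) → Fin d → Fin n := fun x => Function.update x j t
  let F : List (Fin d → Fin n) × Fin n × List.Vector (Fin 3) k → List (Fin d → Fin n) :=
    fun q => List.zipWith (fun w e => Function.update w j (dec q.2.1 e)) (q.1.map p) q.2.2.1
  have hsub : S ⊆ F '' (U ×ˢ (Set.univ : Set (Fin n × List.Vector (Fin 3) k))) := by
    intro l hl
    obtain ⟨w, hw, hlw⟩ := hSU l hl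
    obtain ⟨c, hc⟩ : ∃ c : Fin n, ∀ x ∈ l, ∃ e : Fin 3, dec c e = x j := by
      rcases l with _ | ⟨y, l⟩
      · exact ⟨t, by simp⟩
      · refine ⟨y j, fun x hx => ?_⟩
        have h := hS _ hl x hx y (by simp) j
        refine ⟨⟨x j + 1 - y j, by omega⟩, ?_⟩
        simp only [dec]
        ext
        simp only
        omega
    choose! code hcode using hc
    refine ⟨(w, c, ⟨l.map code, by simp [hk l hl]⟩), ⟨hw, trivial⟩, ?_⟩
    simp only [F]
    rw [← show l.map p = w.map p from hlw, List.zipWith_map, List.zipWith_self]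
    conv_rhs => rw [← List.map_id l]
    refine List.map_congr_left fun x hx => ?_
    simp [p, hcode x hx]
  have hfin : (U ×ˢ (Set.univ : Set (Fin n × List.Vector (Fin 3) k))).Finite :=
    hU.prod Set.finite_univ
  calc S.ncard ≤ _ := Set.ncard_le_ncard hsub (hfin.image F)
    _ ≤ _ := Set.ncard_image_le hfin
    _ = U.ncard * (n * 3 ^ k) := by
      rw [Set.ncard_prod, Set.ncard_univ, Nat.card_prod]
      simp [card_vector]

/-- The `s`-th stage of the retraction of the `j`-th coordinate to `t`: the coordinate is clamped
to an interval that shrinks to `t` as `s` grows. -/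
def clampStage (j : Fin d) (t : Fin n) (s : ℕ) (x : Fin d → Fin n) : Fin d → Fin n :=
  Function.update x j
    ⟨max (min s t) (min (x j) (max (n - 1 - s) t)), by omega⟩

lemma clampStage_zero (j : Fin d) (t : Fin n) : clampStage j t 0 = id := by
  funext x
  refine Function.update_eq_self_iff.2 ?_
  ext
  simp only
  omega

lemma clampStage_last (j : Fin d) (t : Fin n) :
    clampStage j t n = fun x => Function.update x j t := by
  funext x
  unfold clampStage
  congr 1
  ext
  simp only
  omega

lemma cubeAdj.clampStage {x y : Fin d → Fin n} (h : cubeAdj x y) (j : Fin d) (t : Fin n)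
    {s s' : ℕ} (hs : s ≤ s') (hs' : s' ≤ s + 1) :
    cubeAdj (clampStage j t s x) (clampStage j t s' y) := by
  intro i
  have hi := h i
  by_cases hij : i = j
  · subst hij
    simp only [_root_.clampStage, Function.update_self]
    omega
  · simpa [_root_.clampStage, hij] using hi

lemma exists_slice (j : Fin d) (hn : 0 < n) (k : ℕ) (f : List (Fin d → Fin n) → ZMod 2) :
    ∃ t : Fin n, n * {l ∈ cochainSupport (k + 1) f | ∀ x ∈ l, x j = t}.ncard ≤
      (cochainSupport (k + 1) f).ncard := by
  classical
  by_contra! h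
  have hne : (Finset.univ : Finset (Fin n)).Nonempty := ⟨⟨0, hn⟩, Finset.mem_univ _⟩
  have h1 := Finset.sum_lt_sum_of_nonempty hne fun t _ => h t
  have hfin := finite_cochainSupport (k + 1) f
  have h2 : ∑ t : Fin n, {l ∈ cochainSupport (k + 1) f | ∀ x ∈ l, x j = t}.ncard ≤
      (cochainSupport (k + 1) f).ncard := by
    rw [← finsum_eq_sum_of_fintype, ← Set.ncard_iUnion_of_finite]
    · exact Set.ncard_le_ncard (Set.iUnion_subset fun t => Set.sep_subset _ _) hfin
    · exact fun t => hfin.subset (Set.sep_subset _ _)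
    · intro t t' htt'
      refine Set.disjoint_left.2 fun l hl hl' => htt' ?_
      obtain ⟨x, hx⟩ := List.exists_mem_of_length_pos (l := l) (by rw [hl.1.1]; omega)
      rw [← hl.2 x hx, hl'.2 x hx]
  rw [← Finset.mul_sum] at h1
  simp only [Finset.sum_const, Finset.card_univ, Fintype.card_fin, smul_eq_mul] at h1
  exact absurd (Nat.mul_le_mul_left n h2) (not_le.2 h1)

/-- A cocycle is cohomologous, with control of the supports, to its pullback under the projection
to some coordinate slice. -/
lemma exists_projection (j : Fin d) (hn : 0 < n) (k : ℕ) (f : List (Fin d → Fin n) → ZMod 2)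
    (hf : ∀ l, l.length = k + 2 → IsClique l → coboundary f l = 0) :
    ∃ (t : Fin n) (g : List (Fin d → Fin n) → ZMod 2), g [] = 0 ∧
      (∀ l, l.length = k + 1 → IsClique l →
        f l = f (l.map fun x => Function.update x j t) + coboundary g l) ∧
      (cochainSupport (k + 1) fun l => f (l.map fun x => Function.update x j t)).ncard ≤
        3 ^ (k + 1) * (cochainSupport (k + 1) f).ncard ∧
      (cochainSupport k g).ncard ≤
        (k + 1) * 3 ^ k * n * (cochainSupport (k + 1) f).ncard := by
  classical
  obtain ⟨t, ht⟩ := exists_slice j hn k f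
  have hfin := finite_cochainSupport (k + 1) f
  have hclique : ∀ (s : ℕ) (l₁ : List (Fin d → Fin n)) (x : Fin d → Fin n)
      (l₂ : List (Fin d → Fin n)), IsClique (l₁ ++ x :: l₂) →
      IsClique (l₁.map (clampStage j t s) ++ clampStage j t s x ::
        clampStage j t (s + 1) x :: l₂.map (clampStage j t (s + 1))) := by
    intro s l₁ x l₂ hl
    have hmem : ∀ y ∈ l₁.map (clampStage j t s) ++ clampStage j t s x ::
        clampStage j t (s + 1) x :: l₂.map (clampStage j t (s + 1)),
        ∃ z ∈ l₁ ++ x :: l₂, y = clampStage j t s z ∨ y = clampStage j t (s + 1) z := by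
      intro y hy
      simp only [List.mem_append, List.mem_map, List.mem_cons] at hy
      rcases hy with ⟨z, hz, rfl⟩ | rfl | rfl | ⟨z, hz, rfl⟩
      · exact ⟨z, by simp [hz], Or.inl rfl⟩
      · exact ⟨x, by simp, Or.inl rfl⟩
      · exact ⟨x, by simp, Or.inr rfl⟩
      · exact ⟨z, by simp [hz], Or.inr rfl⟩
    intro y hy y' hy'
    obtain ⟨z, hz, h⟩ := hmem y hy
    obtain ⟨z', hz', h'⟩ := hmem y' hy'
    have hzz := hl z hz z' hz'
    rcases h with rfl | rfl <;> rcases h' with rfl | rfl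
    · exact hzz.clampStage j t le_rfl (by omega)
    · exact hzz.clampStage j t (by omega) le_rfl
    · exact (hzz.symm.clampStage j t (by omega) le_rfl).symm
    · exact hzz.clampStage j t le_rfl (by omega)
  refine ⟨t, fun l => ∑ s ∈ Finset.range n,
    prism (clampStage j t s) (clampStage j t (s + 1)) f l, ?_, ?_, ?_, ?_⟩
  · simp [prism]
  · intro l hlen hl
    have h := coboundary_sum_prism (clampStage j t) n f l
    have h0 : ∑ s ∈ Finset.range n,
        prism (clampStage j t s) (clampStage j t (s + 1)) (coboundary f) l = 0 := by
      refine Finset.sum_eq_zero fun s _ => ?_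
      by_contra hne
      obtain ⟨l₁, x, l₂, rfl, hx⟩ := exists_of_prism_ne_zero hne
      refine hx (hf _ ?_ (hclique s l₁ x l₂ hl))
      simp at hlen ⊢
      omega
    rw [h0, add_zero, clampStage_zero, clampStage_last, List.map_id] at h
    rw [h]
    linear_combination -CharTwo.add_self_eq_zero (f (l.map fun x => Function.update x j t))
  · refine (ncard_le_of_projection j t (k + 1) _
      {l ∈ cochainSupport (k + 1) f | ∀ x ∈ l, x j = t} (hfin.subset (Set.sep_subset _ _))
      (fun l hl => hl.1) (fun l hl => hl.2.1) ?_).trans ?_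
    · rintro l ⟨h1, h2, h3⟩
      refine ⟨l.map fun x => Function.update x j t,
        ⟨⟨by simpa using h1, h2.map fun x y hxy => hxy.update j t, h3⟩, ?_⟩, ?_⟩
      · simp only [List.mem_map]
        rintro _ ⟨x, _, rfl⟩
        simp
      · simp
    · calc _ = 3 ^ (k + 1) * (n * {l ∈ cochainSupport (k + 1) f | ∀ x ∈ l, x j = t}.ncard) := by
            ring
        _ ≤ _ := Nat.mul_le_mul_left _ ht
  · let U : Set (List (Fin d → Fin n)) :=
      ⋃ i ∈ Finset.range (k + 1), (fun l => l.eraseIdx i) '' cochainSupport (k + 1) f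
    have hU : U.ncard ≤ (k + 1) * (cochainSupport (k + 1) f).ncard := by
      refine (Finset.set_ncard_biUnion_le _ _).trans ?_
      refine (Finset.sum_le_card_nsmul _ _ _ fun i _ => Set.ncard_image_le hfin).trans ?_
      simp
    have hUfin : U.Finite :=
      Set.Finite.biUnion (Finset.finite_toSet _) fun i _ => hfin.image _
    refine (ncard_le_of_projection j t k _ U hUfin (fun l hl => hl.1) (fun l hl => hl.2.1)
      ?_).trans ?_
    · rintro l ⟨h1, h2, h3⟩
      obtain ⟨s, _, hs⟩ := Finset.exists_ne_zero_of_sum_ne_zero h3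
      obtain ⟨l₁, x, l₂, rfl, hx⟩ := exists_of_prism_ne_zero hs
      refine ⟨l₁.map (clampStage j t s) ++ clampStage j t (s + 1) x ::
        l₂.map (clampStage j t (s + 1)), ?_, ?_⟩
      · refine Set.mem_biUnion (x := l₁.length) ?_ ⟨_, ⟨?_, hclique s l₁ x l₂ h2, hx⟩, ?_⟩
        · simp at h1 ⊢
          omega
        · simp at h1 ⊢
          omega
        · simp [List.eraseIdx_append]
      · simp [clampStage, Function.comp_def]
    · calc _ ≤ (k + 1) * (cochainSupport (k + 1) f).ncard * (n * 3 ^ k) :=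
            Nat.mul_le_mul_right _ hU
        _ = _ := by ring

/-- Projecting a cocycle successively along the first `j` coordinates. -/
lemma exists_iterated_projection (d k j : ℕ) (hj : j ≤ d) : ∃ A C : ℕ, ∀ n : ℕ, 0 < n →
    ∀ f : List (Fin d → Fin n) → ZMod 2,
    (∀ l, l.length = k + 2 → IsClique l → coboundary f l = 0) →
    ∃ (q : (Fin d → Fin n) → Fin d → Fin n) (g : List (Fin d → Fin n) → ZMod 2),
      (∀ x y, cubeAdj x y → cubeAdj (q x) (q y)) ∧
      (∀ x y, (∀ i : Fin d, j ≤ i → x i = y i) → q x = q y) ∧ g [] = 0 ∧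
      (∀ l, l.length = k + 1 → IsClique l → f l = f (l.map q) + coboundary g l) ∧
      (cochainSupport (k + 1) fun l => f (l.map q)).ncard ≤
        A * (cochainSupport (k + 1) f).ncard ∧
      (cochainSupport k g).ncard ≤ C * n * (cochainSupport (k + 1) f).ncard := by
  induction j with
  | zero =>
    refine ⟨1, 0, fun n hn f hf => ⟨id, fun _ => 0, fun x y h => h, fun x y h => ?_, rfl, ?_, ?_, ?_⟩⟩
    · exact funext fun i => h i (Nat.zero_le _)
    · simp [coboundary_zero]
    · simp
    · simp [cochainSupport]
  | succ j ih =>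
    obtain ⟨A, C, h⟩ := ih (by omega)
    refine ⟨3 ^ (k + 1) * A, C + (k + 1) * 3 ^ k * A, fun n hn f hf => ?_⟩
    obtain ⟨q, g, hq, hqj, hg0, hfg, hA, hC⟩ := h n hn f hf
    obtain ⟨t, g', hg0', hfg', hA', hC'⟩ := exists_projection ⟨j, by omega⟩ hn k
      (fun l => f (l.map q)) (fun l h1 h2 => by
        rw [coboundary_comp_map]
        exact hf _ (by simpa using h1) (h2.map hq))
    refine ⟨fun x => q (Function.update x ⟨j, by omega⟩ t), fun l => g l + g' l, ?_, ?_, ?_, ?_,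
      ?_, ?_⟩
    · exact fun x y hxy => hq _ _ (hxy.update _ _)
    · intro x y hxy
      refine hqj _ _ fun i hi => ?_
      by_cases hij : i = ⟨j, by omega⟩
      · rw [hij]; simp
      · have : j ≠ i := fun h => hij (Fin.ext h.symm)
        simpa [hij] using hxy i (by omega)
    · simp [hg0, hg0']
    · intro l h1 h2
      rw [coboundary_add, hfg l h1 h2, hfg' l h1 h2]
      simp only [List.map_map, Function.comp_def]
      ring
    · simp only [List.map_map, Function.comp_def] at hA'
      calc _ ≤ _ := hA'
        _ ≤ 3 ^ (k + 1) * (A * (cochainSupport (k + 1) f).ncard) := Nat.mul_le_mul_left _ hA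
        _ = _ := by ring
    · calc _ ≤ _ := ncard_cochainSupport_add_le k g g'
        _ ≤ C * n * (cochainSupport (k + 1) f).ncard +
            (k + 1) * 3 ^ k * n * (A * (cochainSupport (k + 1) f).ncard) :=
          Nat.add_le_add hC (hC'.trans (Nat.mul_le_mul_left _ hA))
        _ = _ := by ring

/-- A cocycle with small support is the coboundary of a cochain whose support is at most `C * n`
times as large. -/
lemma exists_filling (d k : ℕ) : ∃ C : ℕ, ∀ n : ℕ, 0 < n →
    ∀ f : List (Fin d → Fin n) → ZMod 2,
    (∀ l, l.length = k + 2 → IsClique l → coboundary f l = 0) →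
    C * (cochainSupport (k + 1) f).ncard < n ^ d →
    ∃ g : List (Fin d → Fin n) → ZMod 2, g [] = 0 ∧
      (∀ l, l.length = k + 1 → IsClique l → f l = coboundary g l) ∧
      (cochainSupport k g).ncard ≤ C * n * (cochainSupport (k + 1) f).ncard := by
  obtain ⟨A, C, h⟩ := exists_iterated_projection d k d le_rfl
  refine ⟨A + C, fun n hn f hf hsmall => ?_⟩
  obtain ⟨q, g, -, hqd, hg0, hfg, hA, hC⟩ := h n hn f hf
  have hconst : ∀ x y, q x = q y := fun x y => hqd x y fun i hi => absurd i.2 (by omega)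
  refine ⟨g, hg0, fun l h1 h2 => ?_, hC.trans ?_⟩
  · rw [hfg l h1 h2]
    suffices f (l.map q) = 0 by rw [this, zero_add]
    by_contra hne
    have hsub : Set.range (fun x : Fin d → Fin n => List.replicate (k + 1) x) ⊆
        cochainSupport (k + 1) fun l => f (l.map q) := by
      rintro _ ⟨x, rfl⟩
      refine ⟨by simp, fun y hy z hz => ?_, ?_⟩
      · rw [List.eq_of_mem_replicate hy, List.eq_of_mem_replicate hz]
        exact cubeAdj_refl x
      · have : (List.replicate (k + 1) x).map q = l.map q := by
          rw [List.map_replicate]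
          refine (List.eq_replicate_iff.2 ⟨by simpa using h1, ?_⟩).symm
          simp only [List.mem_map]
          rintro _ ⟨y, _, rfl⟩
          exact hconst y x
        simpa only [this] using hne
    have hcard := Set.ncard_le_ncard hsub (finite_cochainSupport _ _)
    rw [← Set.image_univ, Set.ncard_image_of_injective _ (fun x y hxy =>
      (List.replicate_right_injective k.succ_ne_zero) hxy), Set.ncard_univ] at hcard
    simp only [Nat.card_eq_fintype_card, Fintype.card_pi, Fintype.card_fin, Finset.prod_const,
      Finset.card_univ] at hcard
    rw [Nat.add_mul] at hsmall
    omega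
  · rw [Nat.add_mul, Nat.add_mul]
    exact Nat.le_add_left _ _

section Nerve

variable {ι : Type*} (c : (Fin d → Fin n) → ι)

/-- The pairwise adjacent lists of length `k` that meet every class in `s`. -/
def meetingLists (k : ℕ) (s : Finset ι) : Set (List (Fin d → Fin n)) :=
  {l | l.length = k ∧ IsClique l ∧ ∀ i ∈ s, i ∈ l.map c}

lemma finite_meetingLists (k : ℕ) (s : Finset ι) : (meetingLists c k s).Finite :=
  (List.finite_length_eq _ k).subset fun _ hl => hl.1

lemma ncard_cochainSupport_indicator_le [DecidableEq ι] (k e : ℕ) (s : Finset ι) (hk : 0 < k) :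
    (cochainSupport k fun l => indicatorCochain s.val (l.map c)).ncard ≤
      (meetingLists c (k + e) s).ncard := by
  refine Set.ncard_le_ncard_of_injOn
    (fun l => l ++ (List.replicate e (l.head?.toList)).flatten) ?_ ?_
    (finite_meetingLists c _ s)
  · rintro l ⟨h1, h2, h3⟩
    rcases l with _ | ⟨x, l⟩
    · simp at h1; omega
    · have hmem : ∀ y ∈ x :: l ++ (List.replicate e ((x :: l).head?.toList)).flatten,
          y ∈ x :: l := by
        intro y hy
        simp at hy ⊢
        tauto
      refine ⟨by simp at h1 ⊢; omega, fun y hy z hz => h2 y (hmem y hy) z (hmem z hz), ?_⟩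
      intro i hi
      have h4 : (((x :: l).map c : List ι) : Multiset ι) = s.val := by
        by_contra hne
        exact h3 (if_neg hne)
      have h5 : i ∈ (x :: l).map c := by
        rw [← Multiset.mem_coe, h4]; exact hi
      rw [List.map_append]
      exact List.mem_append_left _ h5
  · intro l hl l' hl' h
    exact (List.append_inj h (hl.1.trans hl'.1.symm)).1

lemma sum_ncard_meetingLists_le [DecidableEq ι] [Fintype ι] (k : ℕ) (s : Finset ι) :
    ∑ j ∈ sᶜ, (meetingLists c k (insert j s)).ncard ≤ k * (meetingLists c k s).ncard := by
  classical
  have hfin := finite_meetingLists c k s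
  have h1 : ∀ j ∈ sᶜ, (meetingLists c k (insert j s)).ncard ≤
      ∑ l ∈ hfin.toFinset, if j ∈ (l.map c).toFinset then 1 else 0 := by
    intro j _
    rw [← Finset.card_filter, ← Set.ncard_coe_finset]
    refine Set.ncard_le_ncard ?_ (Finset.finite_toSet _)
    rintro l ⟨h1, h2, h3⟩
    simp only [Finset.coe_filter, Set.Finite.mem_toFinset, Set.mem_ofPred_eq, List.mem_toFinset]
    exact ⟨⟨h1, h2, fun i hi => h3 i (Finset.mem_insert_of_mem hi)⟩,
      h3 j (Finset.mem_insert_self _ _)⟩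
  refine (Finset.sum_le_sum h1).trans ?_
  rw [Finset.sum_comm, Set.ncard_eq_toFinset_card _ hfin, mul_comm, ← smul_eq_mul]
  refine Finset.sum_le_card_nsmul _ _ _ fun l hl => ?_
  rw [← Finset.card_filter]
  have hl' : l.length = k := ((Set.Finite.mem_toFinset hfin).1 hl).1
  calc _ ≤ (l.map c).toFinset.card := Finset.card_le_card fun j hj => (Finset.mem_filter.1 hj).2
    _ ≤ (l.map c).length := List.toFinset_card_le _
    _ = k := by simpa using hl'

lemma ncard_setOf_cubeAdj_le (a : Fin d → Fin n) : {x | cubeAdj a x}.ncard ≤ 3 ^ d := by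
  have : ({x | cubeAdj a x} : Set (Fin d → Fin n)).ncard ≤
      (Set.univ : Set (Fin d → Fin 3)).ncard := by
    refine Set.ncard_le_ncard_of_injOn
      (fun x i => ⟨min (x i + 1 - a i) 2, by omega⟩) (fun _ _ => trivial) ?_ Set.finite_univ
    intro x hx y hy hxy
    funext i
    have h1 := hx i
    have h2 := hy i
    have h3 := congrFun hxy i
    simp only [Fin.mk.injEq] at h3
    ext
    omega
  simpa [Set.ncard_univ] using this

lemma ncard_meetingLists_le (k : ℕ) {s : Finset ι} {i : ι} (hi : i ∈ s) :
    (meetingLists c k s).ncard ≤ {x | c x = i}.ncard * (3 ^ d) ^ k := by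
  classical
  let B : (Fin d → Fin n) → Set (List (Fin d → Fin n)) :=
    fun a => {l | l.length = k ∧ ∀ x ∈ l, cubeAdj a x}
  have hB : ∀ a, (B a).ncard ≤ (3 ^ d) ^ k := by
    intro a
    have : (B a).ncard ≤
        (Set.univ : Set (List.Vector {x : Fin d → Fin n // cubeAdj a x} k)).ncard := by
      refine (Set.ncard_le_ncard (t := (fun v => v.1.map Subtype.val) '' Set.univ) ?_
        (Set.finite_univ.image _)).trans (Set.ncard_image_le Set.finite_univ)
      rintro l ⟨h1, h2⟩
      exact ⟨⟨l.attachWith _ h2, by simpa using h1⟩, trivial, by simp⟩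
    refine this.trans ?_
    rw [Set.ncard_univ, Nat.card_eq_fintype_card, card_vector]
    refine Nat.pow_le_pow_left ?_ k
    rw [← Nat.card_eq_fintype_card]
    exact ncard_setOf_cubeAdj_le a
  have hfin : {x | c x = i}.Finite := Set.toFinite _
  have hsub : meetingLists c k s ⊆ ⋃ a ∈ hfin.toFinset, B a := by
    rintro l ⟨h1, h2, h3⟩
    obtain ⟨a, ha, hai⟩ := List.mem_map.1 (h3 i hi)
    exact Set.mem_biUnion (x := a) (by simpa using hai) ⟨h1, fun x hx => h2 a ha x hx⟩
  refine (Set.ncard_le_ncard hsub (Set.Finite.biUnion (Finset.finite_toSet _) fun a _ =>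
    (List.finite_length_eq _ k).subset fun _ hl => hl.1)).trans ?_
  refine (Finset.set_ncard_biUnion_le _ _).trans ?_
  refine (Finset.sum_le_card_nsmul _ _ _ fun a _ => hB a).trans ?_
  rw [smul_eq_mul, Set.ncard_eq_toFinset_card _ hfin]

end Nerve

end Grid

/-- Inductive construction, by descending dimension of the simplices of the nerve of the classes of
`c`, of cochains correcting the indicator cochains of simplices of size `m + 1 - e` to cocycles
with small support. -/
lemma exists_corrected_cocycles (d m e : ℕ) (he : e ≤ m) : ∃ C D : ℕ, ∀ n : ℕ, 0 < n →
    ∀ (ι : Type) [Fintype ι] [DecidableEq ι] (c : (Fin d → Fin n) → ι),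
    (∀ l, l.length = m + 2 → IsClique l → ¬ (l.map c).Nodup) →
    (∀ i, D * {x | c x = i}.ncard * n ^ m < n ^ d) →
    ∃ b : Finset ι → List (Fin d → Fin n) → ZMod 2,
      ∀ s : Finset ι, s.card = m + 1 - e → ∃ z : List (Fin d → Fin n) → ZMod 2,
        (∀ l, z l = indicatorCochain s.val (l.map c) + ∑ j ∈ sᶜ, b (insert j s) l) ∧
        (∀ l, l.length = m + 2 - e → IsClique l → coboundary z l = 0) ∧
        (cochainSupport (m + 1 - e) z).ncard ≤
          C * n ^ e * (meetingLists c (m + 1) s).ncard := by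
  induction e with
  | zero =>
    refine ⟨1, 0, fun n hn ι _ _ c hc _ => ⟨fun _ _ => 0, fun s hs =>
      ⟨fun l => indicatorCochain s.val (l.map c), by simp, fun l h1 h2 => ?_, ?_⟩⟩⟩
    · rw [coboundary_comp_map, coboundary_indicatorCochain_finset]
      refine Finset.sum_eq_zero fun j _ => if_neg fun h => hc l h1 h2 ?_
      rw [← Multiset.coe_nodup, h]
      exact (insert j s).nodup
    · simpa using ncard_cochainSupport_indicator_le c (m + 1) 0 s (by omega)
  | succ e ih =>
    obtain ⟨C, D, h⟩ := ih (by omega)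
    obtain ⟨K, hK⟩ := exists_filling d (m - e)
    refine ⟨1 + K * C * (m + 1), D + K * C * (3 ^ d) ^ (m + 1), fun n hn ι _ _ c hc hsmall => ?_⟩
    obtain ⟨b, hb⟩ := h n hn ι c hc fun i => by
      refine lt_of_le_of_lt ?_ (hsmall i)
      gcongr
      omega
    have hfill : ∀ s : Finset ι, ∃ g : List (Fin d → Fin n) → ZMod 2, s.card = m + 1 - e →
        (∀ l, l.length = m + 1 - e → IsClique l → coboundary g l =
          indicatorCochain s.val (l.map c) + ∑ j ∈ sᶜ, b (insert j s) l) ∧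
        (cochainSupport (m - e) g).ncard ≤
          K * C * n ^ (e + 1) * (meetingLists c (m + 1) s).ncard := by
      intro s
      by_cases hs : s.card = m + 1 - e
      swap
      · exact ⟨fun _ => 0, fun h => absurd h hs⟩
      obtain ⟨z, hz, hz0, hzC⟩ := hb s hs
      have e1 : m - e + 1 = m + 1 - e := by omega
      have e2 : m - e + 2 = m + 2 - e := by omega
      obtain ⟨i, hi⟩ : s.Nonempty := Finset.card_pos.1 (by omega)
      obtain ⟨g, -, hg, hgK⟩ := hK n hn z (by rwa [e2]) (by
        rw [e1]
        calc _ ≤ K * (C * n ^ e * ({x | c x = i}.ncard * (3 ^ d) ^ (m + 1))) :=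
              Nat.mul_le_mul_left _ (hzC.trans
                (Nat.mul_le_mul_left _ (ncard_meetingLists_le c (m + 1) hi)))
          _ ≤ K * (C * n ^ m * ({x | c x = i}.ncard * (3 ^ d) ^ (m + 1))) := by
              gcongr
              all_goals omega
          _ ≤ (D + K * C * (3 ^ d) ^ (m + 1)) * {x | c x = i}.ncard * n ^ m := by
              nlinarith [Nat.zero_le (D * {x | c x = i}.ncard * n ^ m)]
          _ < _ := hsmall i)
      rw [e1] at hg hgK
      refine ⟨g, fun _ => ⟨fun l h1 h2 => by rw [← hg l h1 h2, hz], hgK.trans ?_⟩⟩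
      calc _ ≤ K * n * (C * n ^ e * (meetingLists c (m + 1) s).ncard) :=
            Nat.mul_le_mul_left _ hzC
        _ = _ := by ring
    choose b' hb' using hfill
    refine ⟨b', fun s hs => ⟨_, fun l => rfl, fun l h1 h2 => ?_, ?_⟩⟩
    · have hcard : ∀ j ∈ sᶜ, (insert j s).card = m + 1 - e := fun j hj => by
        rw [Finset.card_insert_of_notMem (by simpa using hj)]
        omega
      rw [coboundary_add, coboundary_comp_map (f := indicatorCochain s.val),
        coboundary_indicatorCochain_finset, coboundary_sum, ← Finset.sum_add_distrib]
      rw [← sum_compl_sum_compl_insert s fun t => b t l]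
      refine Finset.sum_congr rfl fun j hj => ?_
      rw [(hb' _ (hcard j hj)).1 l (by omega) h2, ← add_assoc, CharTwo.add_self_eq_zero, zero_add]
    · have e1 : m + 1 - (e + 1) = m - e := by omega
      rw [e1] at hs ⊢
      have hind := ncard_cochainSupport_indicator_le c (m - e) (e + 1) s (by omega)
      rw [show m - e + (e + 1) = m + 1 by omega] at hind
      refine (ncard_cochainSupport_add_le _ _ _).trans ?_
      refine (Nat.add_le_add hind ((ncard_cochainSupport_sum_le _ _ _).trans
        (Finset.sum_le_sum fun j hj => (hb' (insert j s) ?_).2))).trans ?_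
      · rw [Finset.card_insert_of_notMem (by simpa using hj)]
        omega
      · rw [← Finset.mul_sum]
        calc _ ≤ n ^ (e + 1) * (meetingLists c (m + 1) s).ncard + K * C * n ^ (e + 1) *
              ((m + 1) * (meetingLists c (m + 1) s).ncard) :=
            Nat.add_le_add (Nat.le_mul_of_pos_left _ (by positivity))
              (Nat.mul_le_mul_left _ (sum_ncard_meetingLists_le c (m + 1) s))
          _ = _ := by ring

/-- If pairwise adjacent cubes lie in at most `m + 1` classes of `c`, then some class is large. -/
lemma exists_large_class (d m : ℕ) : ∃ D : ℕ, ∀ n : ℕ, 0 < n →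
    ∀ (ι : Type) [Fintype ι] [DecidableEq ι] (c : (Fin d → Fin n) → ι),
    (∀ l, l.length = m + 2 → IsClique l → ¬ (l.map c).Nodup) →
    ∃ i, n ^ d ≤ D * {x | c x = i}.ncard * n ^ m := by
  obtain ⟨C, D, h⟩ := exists_corrected_cocycles d m m le_rfl
  obtain ⟨K, hK⟩ := exists_filling d 0
  refine ⟨D + K * C * (3 ^ d) ^ (m + 1), fun n hn ι _ _ c hc => ?_⟩
  by_contra! hsmall
  obtain ⟨b, hb⟩ := h n hn ι c hc fun i => by
    refine lt_of_le_of_lt ?_ (hsmall i)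
    gcongr
    omega
  have e1 : m + 1 - m = 1 := by omega
  have e2 : m + 2 - m = 2 := by omega
  rw [e1, e2] at hb
  let x : Fin d → Fin n := fun _ => ⟨0, hn⟩
  have hx : IsClique [x] := by
    intro y hy z hz
    rw [List.mem_singleton.1 hy, List.mem_singleton.1 hz]
    exact cubeAdj_refl x
  have hzero : ∀ i, indicatorCochain ({i} : Finset ι).val ([x].map c) +
      ∑ j ∈ ({i} : Finset ι)ᶜ, b (insert j {i}) [x] = 0 := by
    intro i
    obtain ⟨z, hz, hz0, hzC⟩ := hb {i} (by simp)
    obtain ⟨g, hg0, hg, -⟩ := hK n hn z hz0 (by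
      calc _ ≤ K * (C * n ^ m * ({x | c x = i}.ncard * (3 ^ d) ^ (m + 1))) :=
            Nat.mul_le_mul_left _ (hzC.trans
              (Nat.mul_le_mul_left _ (ncard_meetingLists_le c (m + 1) (by simp))))
        _ ≤ (D + K * C * (3 ^ d) ^ (m + 1)) * {x | c x = i}.ncard * n ^ m := by
            nlinarith [Nat.zero_le (D * {x | c x = i}.ncard * n ^ m)]
        _ < _ := hsmall i)
    rw [← hz, hg [x] rfl hx]
    simp [coboundary, hg0]
  have hsum := Finset.sum_eq_zero (s := (∅ : Finset ι)ᶜ) fun i _ => hzero i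
  have hpair := sum_compl_sum_compl_insert (∅ : Finset ι) fun t => b t [x]
  simp only [insert_empty_eq] at hpair
  rw [Finset.sum_add_distrib, hpair, add_zero] at hsum
  have hone := coboundary_indicatorCochain_finset (∅ : Finset ι) ([x].map c)
  simp only [insert_empty_eq] at hone
  rw [hsum] at hone
  simp [coboundary, indicatorCochain] at hone

lemma monoComponent_eq_of_adj {d n : ℕ} {α : Type*} (χ : (Fin d → Fin n) → α)
    {x y : Fin d → Fin n} (hxy : cubeAdj x y) (hχ : χ x = χ y) :
    monoComponent χ x = monoComponent χ y :=
  Set.ext fun _ => ⟨fun h => Relation.ReflTransGen.head ⟨hxy.symm, hχ.symm⟩ h,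
    fun h => Relation.ReflTransGen.head ⟨hxy, hχ⟩ h⟩

/-- If the `n^d` small cubes of the standard partition of the unit cube `[0,1]^d`
are colored in `m + 1` colors (with `m < d`), then some monochromatic connected
component contains at least `f(d, m) · n^(d-m)` small cubes, where `f(d, m) > 0`
depends only on `d` and `m`. -/
theorem cube_coloring_large_component (d m : ℕ) (hd : 1 ≤ d) (hm : m < d) :
    ∃ f : ℝ, 0 < f ∧
      ∀ n : ℕ, 0 < n → ∀ χ : (Fin d → Fin n) → Fin (m + 1),
        ∃ a : Fin d → Fin n,
          f * (n : ℝ) ^ (d - m) ≤ ((monoComponent χ a).ncard : ℝ) := by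
  classical
  obtain ⟨D, hD⟩ := exists_large_class d m
  refine ⟨1 / (D + 1), by positivity, fun n hn χ => ?_⟩
  obtain ⟨i, hi⟩ := hD n hn (Set (Fin d → Fin n)) (monoComponent χ) (by
    intro l h1 h2 hnodup
    have hχ : (l.map χ).Nodup := by
      refine (List.nodup_map_iff_inj_on hnodup.of_map).2 fun x hx y hy hxy => ?_
      exact List.inj_on_of_nodup_map hnodup hx hy
        (monoComponent_eq_of_adj χ (h2 x hx y hy) hxy)
    have := hχ.length_le_card
    simp [h1] at this)
  have hpos : 0 < {x | monoComponent χ x = i}.ncard := by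
    refine Nat.pos_of_ne_zero fun h0 => ?_
    rw [h0, mul_zero, zero_mul] at hi
    exact absurd hi (not_le.2 (by positivity))
  obtain ⟨a, rfl⟩ := Set.nonempty_of_ncard_ne_zero hpos.ne'
  have hle : {x | monoComponent χ x = monoComponent χ a}.ncard ≤ (monoComponent χ a).ncard := by
    refine Set.ncard_le_ncard (fun x hx => ?_) (Set.toFinite _)
    rw [← show monoComponent χ x = monoComponent χ a from hx]
    exact Relation.ReflTransGen.refl
  refine ⟨a, ?_⟩
  have h1 : n ^ (d - m) ≤ D * (monoComponent χ a).ncard := by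
    refine Nat.le_of_mul_le_mul_right ?_ (pow_pos hn m)
    rw [← pow_add, Nat.sub_add_cancel hm.le]
    exact hi.trans (by gcongr)
  have h2 : (n : ℝ) ^ (d - m) ≤ D * ((monoComponent χ a).ncard : ℝ) := by exact_mod_cast h1
  rw [one_div, inv_mul_le_iff₀ (by positivity)]
  have h3 : (0 : ℝ) ≤ ((monoComponent χ a).ncard : ℝ) := by positivity
  linarith
end

section
/- Let d ≥ 1 and n ≥ 1 be integers. For every coloring of the n^d small cubes of the standard partition of the unit cube [0,1]^d in d colors, there exist a color, a coordinate j ∈ {1,…,d}, and a connected set S of small cubes of that color such that S contains a small cube touching the facet {x_j = 0} and a small cube touching the facet {x_j = 1}; in particular, S consists of at least n small cubes. -/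
/-- A set `S` of small cubes is connected if any two of its members are joined
by a chain of adjacent cubes lying in `S`. -/
def cubesConnected {d n : ℕ} (S : Set (Fin d → Fin n)) : Prop :=
  ∀ a ∈ S, ∀ b ∈ S,
    Relation.ReflTransGen (fun x y => x ∈ S ∧ y ∈ S ∧ cubeAdj x y) a b

/-- The facet of a `d`-simplex opposite to its `k`-th vertex is a *door* for the vertex labels `f`
if all labels except the last one occur on it. -/
def IsDoor {d : ℕ} (f : Fin (d + 1) → Fin (d + 1)) (k : Fin (d + 1)) : Prop :=
  ∀ c : Fin d, ∃ j, j ≠ k ∧ f j = c.castSucc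

lemma IsDoor.injOn {d : ℕ} {f : Fin (d + 1) → Fin (d + 1)} {k : Fin (d + 1)}
    (hk : IsDoor f k) : Set.InjOn f {k}ᶜ := by
  classical
  have hcard : (Finset.univ.erase k).card ≤ (Finset.univ.erase (Fin.last d)).card := by simp
  have hsub : Finset.univ.erase (Fin.last d) ⊆ (Finset.univ.erase k).image f := by
    intro x hx
    obtain ⟨c, rfl⟩ := Fin.eq_castSucc_of_ne_last (Finset.ne_of_mem_erase hx)
    obtain ⟨j, hjk, hj⟩ := hk c
    exact Finset.mem_image.2 ⟨j, by simp [hjk], hj⟩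
  have hinj := Finset.card_image_iff.1
    (le_antisymm Finset.card_image_le (hcard.trans (Finset.card_le_card hsub)))
  intro x hx y hy hxy
  exact hinj (by simpa using hx) (by simpa using hy) hxy

open Classical in
/-- A simplex none of whose vertices has the last label has an even number of doors. -/
lemma even_card_doors {d : ℕ} (f : Fin (d + 1) → Fin (d + 1)) (hf : ∀ j, f j ≠ Fin.last d) :
    Even (Finset.univ.filter (IsDoor f)).card := by
  by_cases h : ∃ k, IsDoor f k
  · obtain ⟨k, hk⟩ := h
    obtain ⟨c, hc⟩ := Fin.eq_castSucc_of_ne_last (hf k)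
    obtain ⟨j, hjk, hj⟩ := hk c
    have hfjk : f j = f k := hj.trans hc
    suffices h2 : Finset.univ.filter (IsDoor f) = {k, j} by
      rw [h2, Finset.card_pair hjk.symm]; exact even_two
    ext x
    simp only [Finset.mem_filter, Finset.mem_univ, true_and, Finset.mem_insert,
      Finset.mem_singleton]
    constructor
    · intro hx
      by_contra! hne
      obtain ⟨c', hc'⟩ := Fin.eq_castSucc_of_ne_last (hf x)
      obtain ⟨y, hyx, hy⟩ := hx c'
      have hfyx : f y = f x := hy.trans hc'
      by_cases hyk : y = k
      · subst hyk
        exact hne.2 (hk.injOn hne.1 hjk (by rw [hfjk, hfyx]))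
      · exact hyx (hk.injOn hyk hne.1 hfyx)
    · rintro (rfl | rfl)
      · exact hk
      · intro c'
        obtain ⟨y, hyk, hy⟩ := hk c'
        by_cases hyj : y = x
        · exact ⟨k, hjk.symm, by rw [← hfjk, ← hyj, hy]⟩
        · exact ⟨y, hyj, hy⟩
  · push Not at h
    simp [h]

/-- The `k`-th vertex of the simplex of the Kuhn triangulation of `ℝ^d` encoded by `m`. The
simplices of the triangulation correspond to the vectors `m` with distinct residues mod `d`. -/
def kuhnVertex {d : ℕ} (m : Fin d → ℤ) (k : Fin (d + 1)) : Fin d → ℤ :=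
  fun c => (m c + ((k : ℕ) : ℤ)) / (d : ℤ)

/-- The entries of `m` have distinct residues mod `d`. -/
def DistinctResidues {d : ℕ} (m : Fin d → ℤ) : Prop :=
  ∀ c c' : Fin d, (d : ℤ) ∣ m c - m c' → c = c'

lemma DistinctResidues.exists_dvd_add {d : ℕ} (hd : 0 < d) {m : Fin d → ℤ}
    (hm : DistinctResidues m) (t : ℤ) : ∃ c, (d : ℤ) ∣ m c + t := by
  have hd' : (0 : ℤ) < d := by exact_mod_cast hd
  let g : Fin d → Fin d := fun c => ⟨(m c % d).toNat, by
    have h1 := Int.emod_lt_of_pos (m c) hd'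
    have h2 := Int.emod_nonneg (m c) hd'.ne'
    omega⟩
  have hg : ∀ c, ((g c : ℕ) : ℤ) = m c % d := fun c =>
    Int.toNat_of_nonneg (Int.emod_nonneg (m c) hd'.ne')
  have hinj : Function.Injective g := by
    intro c c' h
    apply hm
    apply Int.dvd_of_emod_eq_zero
    rw [← Int.emod_eq_emod_iff_emod_sub_eq_zero, ← hg, ← hg, h]
  obtain ⟨c, hc⟩ := Finite.surjective_of_injective hinj
    ⟨((-t) % d).toNat, by
      have h1 := Int.emod_lt_of_pos (-t) hd'
      have h2 := Int.emod_nonneg (-t) hd'.ne'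
      omega⟩
  refine ⟨c, ?_⟩
  have h3 : m c % d = (-t) % d := by
    rw [← hg, hc]
    exact Int.toNat_of_nonneg (Int.emod_nonneg _ hd'.ne')
  have := Int.dvd_of_emod_eq_zero (Int.emod_eq_emod_iff_emod_sub_eq_zero.1 h3)
  simpa using this

lemma sub_one_ediv_of_not_dvd {d a : ℤ} (hd : 0 < d) (h : ¬ d ∣ a) : (a - 1) / d = a / d := by
  have h0 : a % d ≠ 0 := fun h0 => h (Int.dvd_of_emod_eq_zero h0)
  have h1 := Int.emod_nonneg a hd.ne'
  have h2 := Int.emod_lt_of_pos a hd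
  have h3 := Int.emod_add_mul_ediv a d
  exact ((Int.ediv_emod_unique (r := a % d - 1) hd).2 ⟨by linarith, by omega, by omega⟩).1

/-- The simplex sharing with the simplex `m` the facet opposite to the `k`-th vertex, for `k`
different from `0` and `d`. -/
def kuhnFlip {d : ℕ} (m : Fin d → ℤ) (k : Fin (d + 1)) : Fin d → ℤ := fun c =>
  if (d : ℤ) ∣ m c + (k : ℕ) then m c - 1
  else if (d : ℤ) ∣ m c + (k : ℕ) + 1 then m c + 1
  else m c

lemma not_dvd_of_interior {d : ℕ} {k : Fin (d + 1)} (h0 : k ≠ 0) (hl : k ≠ Fin.last d)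
    (j : Fin (d + 1)) (hj : j ≠ k) : ¬ (d : ℤ) ∣ (j : ℕ) - (k : ℕ) := by
  intro h
  have h1 : 0 < (k : ℕ) := Nat.pos_of_ne_zero (fun h => h0 (Fin.ext h))
  have h2 : (k : ℕ) < d := lt_of_le_of_ne (Nat.lt_succ_iff.1 k.2) (fun h => hl (Fin.ext h))
  have h3 := j.2
  have := Int.eq_zero_of_abs_lt_dvd h (by rw [abs_lt]; omega)
  exact hj (Fin.ext (by omega))

lemma not_dvd_one_of_interior {d : ℕ} {k : Fin (d + 1)} (h0 : k ≠ 0) (hl : k ≠ Fin.last d) :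
    ¬ (d : ℤ) ∣ 1 := by
  intro h
  have h1 : 0 < (k : ℕ) := Nat.pos_of_ne_zero (fun h => h0 (Fin.ext h))
  have h2 : (k : ℕ) < d := lt_of_le_of_ne (Nat.lt_succ_iff.1 k.2) (fun h => hl (Fin.ext h))
  have := Int.le_of_dvd one_pos h
  omega

lemma kuhnVertex_kuhnFlip {d : ℕ} {k : Fin (d + 1)} (h0 : k ≠ 0) (hl : k ≠ Fin.last d)
    (m : Fin d → ℤ) (j : Fin (d + 1)) (hj : j ≠ k) :
    kuhnVertex (kuhnFlip m k) j = kuhnVertex m j := by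
  funext c
  have hd : (0 : ℤ) < d := by have := c.2; omega
  have hjk := not_dvd_of_interior h0 hl j hj
  simp only [kuhnVertex, kuhnFlip]
  split_ifs with h1 h2
  · rw [← sub_one_ediv_of_not_dvd hd (a := m c + (j : ℕ))]
    · ring_nf
    · intro h
      apply hjk
      exact (dvd_sub h h1).trans (dvd_of_eq (by ring))
  · rw [← sub_one_ediv_of_not_dvd hd (a := m c + 1 + (j : ℕ))]
    · ring_nf
    · intro h
      apply hjk
      exact (dvd_sub h h2).trans (dvd_of_eq (by ring))
  · rfl

lemma kuhnFlip_kuhnFlip {d : ℕ} {k : Fin (d + 1)} (h0 : k ≠ 0) (hl : k ≠ Fin.last d)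
    (m : Fin d → ℤ) : kuhnFlip (kuhnFlip m k) k = m := by
  have hd1 := not_dvd_one_of_interior h0 hl
  funext c
  by_cases h1 : (d : ℤ) ∣ m c + (k : ℕ)
  · have hm : kuhnFlip m k c = m c - 1 := by simp [kuhnFlip, h1]
    have h2 : ¬ (d : ℤ) ∣ m c - 1 + (k : ℕ) := fun h => hd1 ((dvd_sub h1 h).trans (dvd_of_eq (by ring)))
    have h3 : (d : ℤ) ∣ m c - 1 + (k : ℕ) + 1 := h1.trans (dvd_of_eq (by ring))
    rw [kuhnFlip, hm, if_neg h2, if_pos h3]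
    ring
  · by_cases h2 : (d : ℤ) ∣ m c + (k : ℕ) + 1
    · have hm : kuhnFlip m k c = m c + 1 := by simp [kuhnFlip, h1, h2]
      have h3 : (d : ℤ) ∣ m c + 1 + (k : ℕ) := h2.trans (dvd_of_eq (by ring))
      rw [kuhnFlip, hm, if_pos h3]
      ring
    · have hm : kuhnFlip m k c = m c := by simp [kuhnFlip, h1, h2]
      rw [kuhnFlip, hm, if_neg h1, if_neg h2]

lemma kuhnFlip_ne {d : ℕ} (hd : 0 < d) {m : Fin d → ℤ} (hm : DistinctResidues m)
    (k : Fin (d + 1)) : kuhnFlip m k ≠ m := by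
  obtain ⟨c, hc⟩ := hm.exists_dvd_add hd (k : ℕ)
  intro h
  have := congrFun h c
  simp [kuhnFlip, hc] at this

lemma DistinctResidues.kuhnFlip {d : ℕ} {k : Fin (d + 1)} (h0 : k ≠ 0) (hl : k ≠ Fin.last d)
    {m : Fin d → ℤ} (hm : DistinctResidues m) : DistinctResidues (kuhnFlip m k) := by
  have hd1 := not_dvd_one_of_interior h0 hl
  intro c c' h
  apply hm
  simp only [_root_.kuhnFlip] at h
  split_ifs at h with h1 h2 h3 h4 h5 h6 h7
  · exact (dvd_sub h1 h2).trans (dvd_of_eq (by ring))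
  · exact (hd1 ((dvd_sub (dvd_sub h1 h3) h).trans (dvd_of_eq (by ring)))).elim
  · exact (h3 ((dvd_sub h1 h).trans (dvd_of_eq (by ring)))).elim
  · exact (hd1 ((dvd_sub h (dvd_sub h4 h5)).trans (dvd_of_eq (by ring)))).elim
  · exact (dvd_sub h4 h6).trans (dvd_of_eq (by ring))
  · exact (h5 ((dvd_sub h4 h).trans (dvd_of_eq (by ring)))).elim
  · exact (h4 ((dvd_add h h7).trans (dvd_of_eq (by ring)))).elim
  · rename_i h8
    exact (h1 ((dvd_add h h8).trans (dvd_of_eq (by ring)))).elim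
  · exact h

lemma kuhnFlip_mem_Ico {d N : ℕ} {k : Fin (d + 1)} (h0 : k ≠ 0) (hl : k ≠ Fin.last d)
    {m : Fin d → ℤ} {c : Fin d} (hm : m c ∈ Set.Ico (0 : ℤ) (d * N)) :
    kuhnFlip m k c ∈ Set.Ico (0 : ℤ) (d * N) := by
  have hk := not_dvd_of_interior h0 hl 0 h0.symm
  simp only [kuhnFlip, Set.mem_Ico] at *
  split_ifs with h1 h2
  · have : m c ≠ 0 := fun h => hk (by simpa [h] using h1)
    omega
  · have : m c + 1 ≠ d * N := fun h => hk (by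
      have h3 : (d : ℤ) ∣ m c + 1 := h ▸ dvd_mul_right _ _
      exact (dvd_sub h3 h2).trans (dvd_of_eq (by push_cast [Fin.val_zero]; ring)))
    omega
  · exact hm

/-- The neighbour of a pair consisting of a simplex and one of its vertices: the other simplex
with the same opposite facet, and its vertex opposite to this facet. -/
def kuhnNeighbour {d : ℕ} (x : (Fin d → ℤ) × Fin (d + 1)) : (Fin d → ℤ) × Fin (d + 1) :=
  if x.2 = 0 then (x.1 + 1, Fin.last d)
  else if x.2 = Fin.last d then (x.1 - 1, 0)
  else (kuhnFlip x.1 x.2, x.2)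

lemma kuhnNeighbour_kuhnNeighbour {d : ℕ} (hd : 0 < d) (x : (Fin d → ℤ) × Fin (d + 1)) :
    kuhnNeighbour (kuhnNeighbour x) = x := by
  have hne : Fin.last d ≠ 0 := fun h => hd.ne' (congrArg Fin.val h)
  obtain ⟨m, k⟩ := x
  by_cases h0 : k = 0
  · simp [kuhnNeighbour, h0, hne]
  · by_cases hl : k = Fin.last d
    · simp [kuhnNeighbour, hl, hne]
    · simp [kuhnNeighbour, h0, hl, kuhnFlip_kuhnFlip h0 hl]

lemma kuhnNeighbour_ne {d : ℕ} (hd : 0 < d) {x : (Fin d → ℤ) × Fin (d + 1)}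
    (hx : DistinctResidues x.1) : kuhnNeighbour x ≠ x := by
  have hne : Fin.last d ≠ 0 := fun h => hd.ne' (congrArg Fin.val h)
  obtain ⟨m, k⟩ := x
  intro h
  by_cases h0 : k = 0
  · simp [kuhnNeighbour, h0, hne] at h
  · by_cases hl : k = Fin.last d
    · simp [kuhnNeighbour, hl, hne, hne.symm] at h
    · simp only [kuhnNeighbour, h0, hl, if_false, Prod.mk.injEq, and_true] at h
      exact kuhnFlip_ne hd hx k h

lemma DistinctResidues.kuhnNeighbour {d : ℕ} {x : (Fin d → ℤ) × Fin (d + 1)}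
    (hx : DistinctResidues x.1) : DistinctResidues (kuhnNeighbour x).1 := by
  unfold _root_.kuhnNeighbour
  split_ifs with h0 hl
  · intro c c' h
    exact hx c c' (by simpa using h)
  · intro c c' h
    exact hx c c' (by simpa using h)
  · exact hx.kuhnFlip h0 hl

lemma kuhnVertex_add_one {d : ℕ} (m : Fin d → ℤ) (i : Fin d) :
    kuhnVertex (m + 1) i.castSucc = kuhnVertex m i.succ := by
  funext c
  simp only [kuhnVertex, Pi.add_apply, Pi.one_apply, Fin.val_castSucc, Fin.val_succ]
  push_cast
  ring_nf

lemma kuhnVertex_sub_one {d : ℕ} (m : Fin d → ℤ) (i : Fin d) :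
    kuhnVertex (m - 1) i.succ = kuhnVertex m i.castSucc := by
  rw [← kuhnVertex_add_one, sub_add_cancel]

lemma IsDoor.kuhnNeighbour {d : ℕ} {L : (Fin d → ℤ) → Fin (d + 1)}
    {x : (Fin d → ℤ) × Fin (d + 1)} (hx : IsDoor (fun j => L (kuhnVertex x.1 j)) x.2) :
    IsDoor (fun j => L (kuhnVertex (kuhnNeighbour x).1 j)) (kuhnNeighbour x).2 := by
  obtain ⟨m, k⟩ := x
  intro c
  obtain ⟨j, hjk, hj⟩ := hx c
  dsimp only at hjk hj
  unfold _root_.kuhnNeighbour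
  dsimp only
  split_ifs with h0 hl
  · subst h0
    obtain ⟨i, rfl⟩ := Fin.exists_succ_eq.2 hjk
    exact ⟨i.castSucc, Fin.castSucc_ne_last i, by rw [kuhnVertex_add_one, hj]⟩
  · subst hl
    obtain ⟨i, rfl⟩ := Fin.exists_castSucc_eq.2 hjk
    exact ⟨i.succ, Fin.succ_ne_zero i, by rw [kuhnVertex_sub_one, hj]⟩
  · exact ⟨j, hjk, by rw [kuhnVertex_kuhnFlip h0 hl m j hjk, hj]⟩

lemma kuhnVertex_mem_Icc {d N : ℕ} {m : Fin d → ℤ} (hm : ∀ c, m c ∈ Set.Ico (0 : ℤ) (d * N))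
    (k : Fin (d + 1)) (c : Fin d) : kuhnVertex m k c ∈ Set.Icc (0 : ℤ) N := by
  have hd : (0 : ℤ) < d := by have := c.2; omega
  have hk := k.2
  obtain ⟨h1, h2⟩ := hm c
  refine ⟨Int.ediv_nonneg (by omega) hd.le, ?_⟩
  apply Int.lt_add_one_iff.1
  rw [kuhnVertex, Int.ediv_lt_iff_lt_mul hd]
  have : ((N : ℤ) + 1) * d = d * N + d := by ring
  omega

lemma kuhnVertex_le_add_one {d : ℕ} (m : Fin d → ℤ) (j k : Fin (d + 1)) (c : Fin d) :
    kuhnVertex m j c ≤ kuhnVertex m k c + 1 := by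
  have hd : (0 : ℤ) < d := by have := c.2; omega
  have hj := j.2
  have h : (m c + (k : ℕ)) / (d : ℤ) + 1 = (m c + (k : ℕ) + d) / d := by
    rw [Int.add_ediv_of_dvd_right (dvd_refl (d : ℤ)), Int.ediv_self hd.ne']
  rw [kuhnVertex, kuhnVertex, h]
  exact Int.ediv_le_ediv hd (by omega)

lemma kuhnVertex_mono {d : ℕ} (m : Fin d → ℤ) (c : Fin d) :
    Monotone (fun k => kuhnVertex m k c) := by
  intro j k hjk
  have hd : (0 : ℤ) < d := by have := c.2; omega
  have : (j : ℕ) ≤ (k : ℕ) := hjk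
  exact Int.ediv_le_ediv hd (by omega)

/-- The simplex with vertices `0`, `e₀`, `e₀ + e₁`, …. -/
def cornerSimplex (d : ℕ) : Fin d → ℤ := fun i => d - 1 - (i : ℕ)

lemma distinctResidues_cornerSimplex (d : ℕ) : DistinctResidues (cornerSimplex d) := by
  intro c c' h
  have h1 := c.2
  have h2 := c'.2
  simp only [cornerSimplex] at h
  have := Int.eq_zero_of_abs_lt_dvd h (by rw [abs_lt]; omega)
  exact Fin.ext (by omega)

lemma cornerSimplex_mem_Ico {d N : ℕ} (hN : 0 < N) (c : Fin d) :
    cornerSimplex d c ∈ Set.Ico (0 : ℤ) (d * N) := by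
  have h1 := c.2
  have h2 : (d : ℤ) * 1 ≤ d * N := by gcongr; exact_mod_cast hN
  simp only [cornerSimplex, Set.mem_Ico]
  omega

lemma exists_first_zero {d : ℕ} {v : Fin d → ℤ} (h : ∃ c, v c = 0) :
    ∃ c, v c = 0 ∧ ∀ c' < c, v c' ≠ 0 := by
  obtain ⟨c, hc, hmin⟩ := WellFounded.has_min (wellFounded_lt (α := Fin d)) {c | v c = 0} h
  exact ⟨c, hc, fun c' hlt h0 => hmin c' h0 hlt⟩

/-- The labels that a labelling assigns to the points of the cube `[0, N]^d` on the facets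
through the origin are determined by the first vanishing coordinate. -/
def CanonicalOnLowerFacets {d : ℕ} (N : ℕ) (L : (Fin d → ℤ) → Fin (d + 1)) : Prop :=
  ∀ (v : Fin d → ℤ) (c : Fin d), (∀ i, v i ∈ Set.Icc (0 : ℤ) N) → v c = 0 →
    (∀ c' < c, v c' ≠ 0) → L v = c.castSucc

lemma isDoor_cornerSimplex {d N : ℕ} (hN : 0 < N) {L : (Fin d → ℤ) → Fin (d + 1)}
    (hL : CanonicalOnLowerFacets N L) :
    IsDoor (fun j => L (kuhnVertex (cornerSimplex d) j)) (Fin.last d) := by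
  intro c
  have hc := c.2
  refine ⟨c.castSucc, Fin.castSucc_ne_last c, hL _ c
    (kuhnVertex_mem_Icc (cornerSimplex_mem_Ico hN) _) ?_ ?_⟩
  · simp only [kuhnVertex, cornerSimplex, Fin.val_castSucc]
    exact Int.ediv_eq_zero_of_lt (by omega) (by omega)
  · intro c' hlt
    have : (c' : ℕ) < (c : ℕ) := hlt
    simp only [kuhnVertex, cornerSimplex, Fin.val_castSucc]
    apply ne_of_gt
    apply Int.lt_iff_add_one_le.2
    rw [zero_add, Int.le_ediv_iff_mul_le (by omega)]
    omega

lemma eq_cornerSimplex_of_isDoor {d N : ℕ} {L : (Fin d → ℤ) → Fin (d + 1)}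
    (hL : CanonicalOnLowerFacets N L) {m : Fin d → ℤ}
    (hm : ∀ c, m c ∈ Set.Ico (0 : ℤ) (d * N))
    (hdoor : IsDoor (fun j => L (kuhnVertex m j)) (Fin.last d)) {c₀ : Fin d} (h0 : m c₀ = 0) :
    m = cornerSimplex d := by
  have hzero : ∀ j : Fin d, ∃ c, kuhnVertex m j.castSucc c = 0 := by
    intro j
    have hj := j.2
    refine ⟨c₀, ?_⟩
    simp only [kuhnVertex, h0, Fin.val_castSucc]
    exact Int.ediv_eq_zero_of_lt (by omega) (by omega)
  choose l hl hmin using fun j => exists_first_zero (hzero j)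
  have hlabel : ∀ j : Fin d, L (kuhnVertex m j.castSucc) = (l j).castSucc := fun j =>
    hL _ _ (kuhnVertex_mem_Icc hm _) (hl j) (hmin j)
  have hsurj : Function.Surjective l := by
    intro c
    obtain ⟨j, hj, hjc⟩ := hdoor c
    obtain ⟨i, rfl⟩ := Fin.exists_castSucc_eq.2 hj
    exact ⟨i, Fin.castSucc_injective d ((hlabel i).symm.trans hjc)⟩
  have hmono : Monotone l := by
    intro i j hij
    by_contra! hlt
    refine hmin i (l j) hlt (le_antisymm ?_ (kuhnVertex_mem_Icc hm _ _).1)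
    exact (kuhnVertex_mono m (l j) (Fin.castSucc_le_castSucc_iff.2 hij)).trans_eq (hl j)
  have hid : l = id := by
    refine ((hmono.strictMono_of_injective
      (Finite.injective_iff_surjective.2 hsurj)).range_inj strictMono_id).1 ?_
    rw [hsurj.range_eq, Set.range_id]
  subst hid
  funext i
  have hi := i.2
  have hd : (0 : ℤ) < d := by omega
  obtain ⟨hm0, -⟩ := hm i
  have hlt := (Int.ediv_lt_iff_lt_mul hd).1 (Int.lt_add_one_iff.2 (hl i).le)
  simp only [id, Fin.val_castSucc, zero_add, one_mul] at hlt
  simp only [cornerSimplex]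
  by_cases hlast : (i : ℕ) + 1 < d
  · have hne := hmin ⟨i + 1, hlast⟩ i (Nat.lt_succ_self i)
    have hge : (d : ℤ) ≤ m i + (i + 1) := by
      by_contra! hlt'
      refine hne ?_
      simp only [kuhnVertex, Fin.val_castSucc]
      exact Int.ediv_eq_zero_of_lt (by omega) (by push_cast; omega)
    omega
  · omega

/-- The neighbour of a door in the cube lies in the cube, except for one door on the boundary. -/
lemma kuhnNeighbour_mem_Ico {d N : ℕ} {L : (Fin d → ℤ) → Fin (d + 1)}
    (hL : CanonicalOnLowerFacets N L)
    (hhigh : ∀ (v : Fin d → ℤ) (c : Fin d), L v = c.castSucc → v c ≠ N)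
    {x : (Fin d → ℤ) × Fin (d + 1)} (hx : ∀ c, x.1 c ∈ Set.Ico (0 : ℤ) (d * N))
    (hdoor : IsDoor (fun j => L (kuhnVertex x.1 j)) x.2)
    (hne : x ≠ (cornerSimplex d, Fin.last d)) (c : Fin d) :
    (kuhnNeighbour x).1 c ∈ Set.Ico (0 : ℤ) (d * N) := by
  obtain ⟨m, k⟩ := x
  dsimp only at hx hdoor
  have hd : (0 : ℤ) < d := by have := c.2; omega
  have hc := hx c
  unfold kuhnNeighbour
  dsimp only
  split_ifs with h0 hl
  · subst h0
    suffices m c + 1 ≠ d * N by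
      simp only [Set.mem_Ico, Pi.add_apply, Pi.one_apply] at *
      omega
    intro h
    obtain ⟨j, hj, hjc⟩ := hdoor c
    have hj0 : 0 < (j : ℕ) := Nat.pos_of_ne_zero (fun h => hj (Fin.ext h))
    refine hhigh _ c hjc (le_antisymm (kuhnVertex_mem_Icc hx j c).2 ?_)
    rw [kuhnVertex, Int.le_ediv_iff_mul_le hd, mul_comm]
    omega
  · subst hl
    suffices m c ≠ 0 by
      simp only [Set.mem_Ico, Pi.sub_apply, Pi.one_apply] at *
      omega
    intro h
    exact hne (by rw [eq_cornerSimplex_of_isDoor hL hx hdoor h])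
  · exact kuhnFlip_mem_Ico h0 hl hc

open Classical in
/-- A version of Sperner's lemma for the Kuhn triangulation of the cube `[0, N]^d`. -/
lemma exists_rainbow_kuhnSimplex {d N : ℕ} (hd : 0 < d) (hN : 0 < N)
    {L : (Fin d → ℤ) → Fin (d + 1)} (hL : CanonicalOnLowerFacets N L)
    (hhigh : ∀ (v : Fin d → ℤ) (c : Fin d), L v = c.castSucc → v c ≠ N) :
    ∃ m : Fin d → ℤ, (∀ c, m c ∈ Set.Ico (0 : ℤ) (d * N)) ∧
      ∀ l, ∃ j, L (kuhnVertex m j) = l := by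
  by_contra! hno
  let B : Finset (Fin d → ℤ) :=
    (Fintype.piFinset fun _ => Finset.Ico (0 : ℤ) (d * N)).filter DistinctResidues
  have hB : ∀ m, m ∈ B ↔ (∀ c, m c ∈ Set.Ico (0 : ℤ) (d * N)) ∧ DistinctResidues m := by
    intro m
    simp [B, Fintype.mem_piFinset]
  let X : Finset ((Fin d → ℤ) × Fin (d + 1)) :=
    (B ×ˢ Finset.univ).filter fun x => IsDoor (fun j => L (kuhnVertex x.1 j)) x.2
  have hX : ∀ x, x ∈ X ↔ ((∀ c, x.1 c ∈ Set.Ico (0 : ℤ) (d * N)) ∧ DistinctResidues x.1) ∧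
      IsDoor (fun j => L (kuhnVertex x.1 j)) x.2 := by
    intro x
    simp [X, hB]
  have heven : Even X.card := by
    rw [Finset.card_filter, Finset.sum_product]
    refine Finset.even_sum _ fun m hm => ?_
    rw [← Finset.card_filter]
    by_cases hlast : ∃ j, L (kuhnVertex m j) = Fin.last d
    · obtain ⟨l, hl⟩ := hno m ((hB m).1 hm).1
      suffices h : ∀ k, ¬ IsDoor (fun j => L (kuhnVertex m j)) k by simp [h]
      intro k hk
      obtain ⟨c, rfl⟩ := Fin.eq_castSucc_of_ne_last
        (x := l) (by rintro rfl; exact hlast.elim hl)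
      obtain ⟨j, -, hj⟩ := hk c
      exact hl j hj
    · push Not at hlast
      exact even_card_doors _ hlast
  have hcorner : (cornerSimplex d, Fin.last d) ∈ X :=
    (hX _).2 ⟨⟨cornerSimplex_mem_Ico hN, distinctResidues_cornerSimplex d⟩,
      isDoor_cornerSimplex hN hL⟩
  have heven_erase : Even (X.erase (cornerSimplex d, Fin.last d)).card := by
    rw [← ZMod.natCast_eq_zero_iff_even, Finset.cast_card]
    refine Finset.sum_involution (fun x _ => kuhnNeighbour x) (fun _ _ => by decide)
      (fun x hx _ => ?_) (fun x hx => ?_) (fun x _ => kuhnNeighbour_kuhnNeighbour hd x)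
    · exact kuhnNeighbour_ne hd ((hX x).1 (Finset.mem_of_mem_erase hx)).1.2
    · obtain ⟨hne, hx⟩ := Finset.mem_erase.1 hx
      obtain ⟨⟨hbox, hdist⟩, hdoor⟩ := (hX x).1 hx
      refine Finset.mem_erase.2 ⟨fun h => ?_, (hX _).2
        ⟨⟨kuhnNeighbour_mem_Ico hL hhigh hbox hdoor hne, hdist.kuhnNeighbour⟩,
          hdoor.kuhnNeighbour⟩⟩
      have hxm : x = (cornerSimplex d - 1, 0) := by
        rw [← kuhnNeighbour_kuhnNeighbour hd x, h]
        have hl : Fin.last d ≠ 0 := fun h => hd.ne' (congrArg Fin.val h)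
        simp [kuhnNeighbour, hl]
      have := (hbox ⟨d - 1, by omega⟩).1
      simp only [hxm, cornerSimplex, Pi.sub_apply, Pi.one_apply] at this
      omega
  rw [Finset.card_erase_of_mem hcorner] at heven_erase
  have := Finset.card_pos.2 ⟨_, hcorner⟩
  obtain ⟨a, ha⟩ := heven
  obtain ⟨b, hb⟩ := heven_erase
  omega

/-- Adjacent small cubes of the same color. -/
def SameColorAdj {d n : ℕ} (χ : (Fin d → Fin n) → Fin d) (a b : Fin d → Fin n) : Prop :=
  χ a = χ b ∧ cubeAdj a b

lemma SameColorAdj.symm {d n : ℕ} {χ : (Fin d → Fin n) → Fin d} {a b : Fin d → Fin n}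
    (h : SameColorAdj χ a b) : SameColorAdj χ b a :=
  ⟨h.1.symm, fun i => (h.2 i).symm⟩

open Relation in
lemma color_eq_of_reflTransGen {d n : ℕ} {χ : (Fin d → Fin n) → Fin d} {a b : Fin d → Fin n}
    (h : ReflTransGen (SameColorAdj χ) a b) : χ a = χ b := by
  induction h with
  | refl => rfl
  | tail _ h ih => exact ih.trans h.1

open Relation in
/-- The color component of a cube is connected. -/
lemma cubesConnected_component {d n : ℕ} (χ : (Fin d → Fin n) → Fin d) (b : Fin d → Fin n) :
    cubesConnected {x | ReflTransGen (SameColorAdj χ) b x} := by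
  intro x hx y hy
  have hlift : ∀ {u v}, ReflTransGen (SameColorAdj χ) b u → ReflTransGen (SameColorAdj χ) u v →
      ReflTransGen (fun x y => x ∈ {x | ReflTransGen (SameColorAdj χ) b x} ∧
        y ∈ {x | ReflTransGen (SameColorAdj χ) b x} ∧ cubeAdj x y) u v := by
    intro u v hu huv
    induction huv with
    | refl => exact .refl
    | tail h1 h2 ih => exact ih.tail ⟨hu.trans h1, (hu.trans h1).tail h2, h2.2⟩
  have : Std.Symm (SameColorAdj χ) := ⟨fun _ _ h => h.symm⟩
  exact hlift hx ((ReflTransGen.stdSymm.symm _ _ hx).trans hy)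

open Relation in
/-- Coordinates change by at most one along a chain, so no intermediate value is skipped. -/
lemma exists_apply_eq_of_reflTransGen {d n : ℕ} {χ : (Fin d → Fin n) → Fin d}
    {a b : Fin d → Fin n} {j : Fin d} (hb : (b j : ℕ) = 0)
    (h : ReflTransGen (SameColorAdj χ) b a) :
    ∀ t ≤ a j, ∃ x, ReflTransGen (SameColorAdj χ) b x ∧ x j = t := by
  induction h with
  | refl =>
    intro t ht
    refine ⟨b, .refl, Fin.ext ?_⟩
    have : (t : ℕ) ≤ (b j : ℕ) := ht
    omega
  | @tail x y h1 h2 ih =>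
    intro t ht
    by_cases hx : t ≤ x j
    · exact ih t hx
    · refine ⟨y, h1.tail h2, Fin.ext ?_⟩
      have h3 : (t : ℕ) ≤ (y j : ℕ) := ht
      have h4 : (x j : ℕ) < (t : ℕ) := not_le.1 hx
      have h5 := (h2.2 j).2
      omega

open Relation in
/-- The component of `b` spans the `j`-th direction if it joins the two opposite facets. -/
lemma spanning_of_reflTransGen {d n : ℕ} {χ : (Fin d → Fin n) → Fin d}
    {a b : Fin d → Fin n} {j : Fin d} (hb : (b j : ℕ) = 0) (ha : (a j : ℕ) = n - 1)
    (h : ReflTransGen (SameColorAdj χ) b a) :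
    ∃ (c : Fin d) (j : Fin d) (S : Set (Fin d → Fin n)),
      (∀ a ∈ S, χ a = c) ∧ cubesConnected S ∧
      (∃ a ∈ S, (a j : ℕ) = 0) ∧ (∃ a ∈ S, (a j : ℕ) = n - 1) ∧
      n ≤ S.ncard := by
  refine ⟨χ b, j, {x | ReflTransGen (SameColorAdj χ) b x},
    fun x hx => (color_eq_of_reflTransGen hx).symm, cubesConnected_component χ b,
    ⟨b, .refl, hb⟩, ⟨a, h, ha⟩, ?_⟩
  have himage : (fun x : Fin d → Fin n => x j) '' {x | ReflTransGen (SameColorAdj χ) b x} =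
      Set.univ := by
    refine Set.eq_univ_of_forall fun t => exists_apply_eq_of_reflTransGen hb h t ?_
    have := t.2
    exact Fin.le_def.2 (by omega)
  calc n = (Set.univ : Set (Fin n)).ncard := by simp
    _ ≤ _ := himage ▸ Set.ncard_image_le (Set.toFinite _)

/-- The small cube with index `v - 1`, for `v` in `{1, …, n}^d`. -/
def cubeOfPoint {d n : ℕ} (hn : 1 ≤ n) (v : Fin d → ℤ) : Fin d → Fin n :=
  fun c => ⟨min (v c - 1).toNat (n - 1), by omega⟩

lemma cubeAdj_cubeOfPoint {d n : ℕ} (hn : 1 ≤ n) {v w : Fin d → ℤ}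
    (h : ∀ c, v c ≤ w c + 1 ∧ w c ≤ v c + 1) :
    cubeAdj (cubeOfPoint hn v) (cubeOfPoint hn w) := by
  intro c
  have := h c
  simp only [cubeOfPoint]
  omega

open Relation in
/-- A cube of color `c` is *lower* if its component touches the facet `x_c = 0`. -/
def IsLower {d n : ℕ} (χ : (Fin d → Fin n) → Fin d) (a : Fin d → Fin n) : Prop :=
  ∃ b, (b (χ a) : ℕ) = 0 ∧ ReflTransGen (SameColorAdj χ) b a

/-- The label of a point of `[0, n + 1]^d`: on the boundary it is canonical, and an interior point
gets the color of its cube if the cube is lower, and the last label otherwise. -/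
def IsLabel {d n : ℕ} (hn : 1 ≤ n) (χ : (Fin d → Fin n) → Fin d) (v : Fin d → ℤ)
    (l : Fin (d + 1)) : Prop :=
  (∃ c, v c = 0 ∧ (∀ c' < c, v c' ≠ 0) ∧ l = c.castSucc) ∨
  ((∀ c, v c ≠ 0) ∧ (∃ c, v c = (n + 1 : ℕ)) ∧ l = Fin.last d) ∨
  ((∀ c, v c ≠ 0) ∧ (∀ c, v c ≠ (n + 1 : ℕ)) ∧ IsLower χ (cubeOfPoint hn v) ∧
    l = (χ (cubeOfPoint hn v)).castSucc) ∨
  ((∀ c, v c ≠ 0) ∧ (∀ c, v c ≠ (n + 1 : ℕ)) ∧ ¬ IsLower χ (cubeOfPoint hn v) ∧ l = Fin.last d)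

lemma exists_isLabel {d n : ℕ} (hn : 1 ≤ n) (χ : (Fin d → Fin n) → Fin d) (v : Fin d → ℤ) :
    ∃ l, IsLabel hn χ v l := by
  by_cases h0 : ∃ c, v c = 0
  · obtain ⟨c, hc, hmin⟩ := exists_first_zero h0
    exact ⟨_, .inl ⟨c, hc, hmin, rfl⟩⟩
  push Not at h0
  by_cases h1 : ∃ c, v c = (n + 1 : ℕ)
  · exact ⟨_, .inr (.inl ⟨h0, h1, rfl⟩)⟩
  push Not at h1
  by_cases h2 : IsLower χ (cubeOfPoint hn v)
  · exact ⟨_, .inr (.inr (.inl ⟨h0, h1, h2, rfl⟩))⟩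
  · exact ⟨_, .inr (.inr (.inr ⟨h0, h1, h2, rfl⟩))⟩

lemma IsLabel.eq_of_zero {d n : ℕ} {hn : 1 ≤ n} {χ : (Fin d → Fin n) → Fin d} {v : Fin d → ℤ}
    {l : Fin (d + 1)} (h : IsLabel hn χ v l) {c : Fin d} (hc : v c = 0)
    (hmin : ∀ c' < c, v c' ≠ 0) : l = c.castSucc := by
  obtain ⟨c', hc', hmin', rfl⟩ | h | h | h := h
  · rcases lt_trichotomy c c' with hlt | rfl | hlt
    · exact (hmin' c hlt hc).elim
    · rfl
    · exact (hmin c' hlt hc').elim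
  all_goals exact (h.1 c hc).elim

lemma IsLabel.castSucc {d n : ℕ} {hn : 1 ≤ n} {χ : (Fin d → Fin n) → Fin d} {v : Fin d → ℤ}
    {c : Fin d} (h : IsLabel hn χ v c.castSucc) :
    v c = 0 ∨ v c ≠ (n + 1 : ℕ) ∧ IsLower χ (cubeOfPoint hn v) ∧
      χ (cubeOfPoint hn v) = c := by
  obtain ⟨c', hc', -, h⟩ | ⟨-, -, h⟩ | ⟨-, h1, h2, h⟩ | ⟨-, -, -, h⟩ := h
  · obtain rfl := Fin.castSucc_injective d h
    exact .inl hc'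
  · exact (Fin.castSucc_ne_last c h).elim
  · exact .inr ⟨h1 c, h2, (Fin.castSucc_injective d h).symm⟩
  · exact (Fin.castSucc_ne_last c h).elim

lemma IsLabel.last {d n : ℕ} {hn : 1 ≤ n} {χ : (Fin d → Fin n) → Fin d} {v : Fin d → ℤ}
    (h : IsLabel hn χ v (Fin.last d)) :
    (∃ c, v c = (n + 1 : ℕ)) ∨ (∀ c, v c ≠ 0) ∧ ¬ IsLower χ (cubeOfPoint hn v) := by
  obtain ⟨c', -, -, h⟩ | ⟨-, h, -⟩ | ⟨-, -, -, h⟩ | ⟨h1, -, h2, -⟩ := h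
  · exact (Fin.castSucc_ne_last c' h.symm).elim
  · exact .inl h
  · exact (Fin.castSucc_ne_last _ h.symm).elim
  · exact .inr ⟨h1, h2⟩

/-- HEX lemma / discrete Sitnikov theorem: for every coloring of the `n^d` small
cubes of the standard partition of `[0,1]^d` in `d` colors there is a color, a
coordinate `j`, and a connected monochromatic set `S` of cubes of that color
containing a cube touching the facet `{x_j = 0}` (i.e. with `a j = 0`) and a
cube touching the facet `{x_j = 1}` (i.e. with `a j = n - 1`); in particular
`S` has at least `n` elements. -/
theorem hex_spanning_component (d n : ℕ) (hd : 1 ≤ d) (hn : 1 ≤ n)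
    (χ : (Fin d → Fin n) → Fin d) :
    ∃ (c : Fin d) (j : Fin d) (S : Set (Fin d → Fin n)),
      (∀ a ∈ S, χ a = c) ∧ cubesConnected S ∧
      (∃ a ∈ S, (a j : ℕ) = 0) ∧ (∃ a ∈ S, (a j : ℕ) = n - 1) ∧
      n ≤ S.ncard := by
  choose L hL using exists_isLabel hn χ
  obtain ⟨m, hm, hrainbow⟩ := exists_rainbow_kuhnSimplex (N := n + 1) (L := L) hd (by omega)
    (fun v c _ hc hmin => (hL v).eq_of_zero hc hmin) (fun v c hv => by
      rcases (show IsLabel hn χ v c.castSucc from hv ▸ hL v).castSucc with h | h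
      · rw [h]; push_cast; omega
      · exact h.1)
  have hadj := kuhnVertex_le_add_one m
  obtain ⟨j, hj⟩ := hrainbow (Fin.last d)
  rcases (show IsLabel hn χ (kuhnVertex m j) (Fin.last d) from hj ▸ hL _).last with
    ⟨c, hc⟩ | ⟨hne, hnot⟩
  · obtain ⟨k, hk⟩ := hrainbow c.castSucc
    have hjk := hadj j k c
    have hle := (kuhnVertex_mem_Icc hm k c).2
    push_cast at hc hle
    rcases (show IsLabel hn χ (kuhnVertex m k) c.castSucc from hk ▸ hL _).castSucc with
      h | ⟨h, ⟨b, hb, hba⟩, hcol⟩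
    · omega
    · push_cast at h
      rw [hcol] at hb
      refine spanning_of_reflTransGen hb ?_ hba
      simp only [cubeOfPoint]
      omega
  · set c := χ (cubeOfPoint hn (kuhnVertex m j)) with hcdef
    obtain ⟨k, hk⟩ := hrainbow c.castSucc
    rcases (show IsLabel hn χ (kuhnVertex m k) c.castSucc from hk ▸ hL _).castSucc with
      h | ⟨-, ⟨b, hb, hba⟩, hcol⟩
    · refine (hnot ⟨_, ?_, .refl⟩).elim
      have hjk := hadj j k c
      have hnec := hne c
      rw [← hcdef]
      simp only [cubeOfPoint]
      omega
    · refine (hnot ⟨b, by rwa [hcol] at hb, hba.tail ⟨hcol, ?_⟩⟩).elim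
      exact cubeAdj_cubeOfPoint hn fun i => ⟨hadj k j i, hadj j k i⟩
end
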